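/- Let A be a unital C*-algebra and φ : A → A a linear map that is unital (φ(1) = 1) and 2-positive, in the sense that for every R ∈ Matrix(Fin 2, Fin 2, A) there exists S ∈ Matrix(Fin 2, Fin 2, A) such that the entrywise image (Rᴴ * R).map φ equals Sᴴ * S, where Rᴴ denotes the conjugate-transpose matrix (transpose with the star applied to each entry). Then φ satisfies the Størmer (Kadison–Schwarz) inequality: for every x ∈ A, φ(x)⋆ * φ(x) ≤ φ(x⋆ * x), where ≤ is the canonical order on the C*-algebra A. -/

import Mathlib

open Matrix

/-- In a unital C⋆-algebra, a sum of two elements of the form `star p * p` is again of that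
form. -/
theorem exists_star_mul_self_add_star_mul_self_eq {A : Type*} [CStarAlgebra A] (p q : A) :
    ∃ b : A, star p * p + star q * q = star b * b := by
  let _ : PartialOrder A := CStarAlgebra.spectralOrder A
  have _ : StarOrderedRing A := CStarAlgebra.spectralOrderedRing A
  exact CStarAlgebra.nonneg_iff_eq_star_mul_self.mp
    (add_nonneg (star_mul_self_nonneg p) (star_mul_self_nonneg q))

/-- **Størmer (Kadison–Schwarz) inequality for 2-positive unital maps.**
If `φ` is a unital linear map on a unital C*-algebra `A` which is 2-positive (it maps
nonnegative 2×2 matrices over `A` to nonnegative ones, nonnegativity being witnessed as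
`Rᴴ * R`), then `φ(x)⋆ φ(x) ≤ φ(x⋆ x)` for all `x`, i.e. `φ(x⋆ x) − φ(x)⋆ φ(x)` is
nonnegative (of the form `b⋆ b`). -/
theorem stormer_inequality_of_two_positive
    {A : Type*} [NormedRing A] [StarRing A] [CStarRing A] [NormedAlgebra ℂ A]
    [CompleteSpace A] [StarModule ℂ A]
    (φ : A →ₗ[ℂ] A) (hunital : φ 1 = 1)
    (h2pos : ∀ R : Matrix (Fin 2) (Fin 2) A, ∃ S : Matrix (Fin 2) (Fin 2) A,
      (Rᴴ * R).map φ = Sᴴ * S) :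
    ∀ x : A, ∃ b : A, φ (star x * x) - star (φ x) * φ x = star b * b := by
  intro x
  let _ : CStarAlgebra A := {}
  obtain ⟨S, hS⟩ := h2pos !![1, x; 0, 0]
  have h00 : star (S 0 0) * S 0 0 + star (S 1 0) * S 1 0 = 1 := by
    simpa [Matrix.mul_apply, Fin.sum_univ_two, hunital] using (congr_fun₂ hS 0 0).symm
  have h01 : star (S 0 0) * S 0 1 + star (S 1 0) * S 1 1 = φ x := by
    simpa [Matrix.mul_apply, Fin.sum_univ_two] using (congr_fun₂ hS 0 1).symm
  have h11 : star (S 0 1) * S 0 1 + star (S 1 1) * S 1 1 = φ (star x * x) := by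
    simpa [Matrix.mul_apply, Fin.sum_univ_two] using (congr_fun₂ hS 1 1).symm
  have h10 : star (S 0 1) * S 0 0 + star (S 1 1) * S 1 0 = star (φ x) := by
    simp [← h01]
  obtain ⟨b, hb⟩ := exists_star_mul_self_add_star_mul_self_eq
    (S 0 1 - S 0 0 * φ x) (S 1 1 - S 1 0 * φ x)
  refine ⟨b, hb ▸ ?_⟩
  generalize φ x = y at *
  symm
  calc star (S 0 1 - S 0 0 * y) * (S 0 1 - S 0 0 * y)
        + star (S 1 1 - S 1 0 * y) * (S 1 1 - S 1 0 * y)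
      = (star (S 0 1) * S 0 1 + star (S 1 1) * S 1 1)
        - (star (S 0 1) * S 0 0 + star (S 1 1) * S 1 0) * y
        - star y * (star (S 0 0) * S 0 1 + star (S 1 0) * S 1 1)
        + star y * (star (S 0 0) * S 0 0 + star (S 1 0) * S 1 0) * y := by
        simp only [star_sub, star_mul]
        noncomm_ring
    _ = φ (star x * x) - star y * y := by
        rw [h00, h01, h10, h11]
        noncomm_ring
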